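/- Let k ≥ 1 and let X be a nonempty finite index set. For every x ∈ X let ⋃_{i ∈ I_x} L(C_i, P_i) be a semilinear subset of ℕ^k, where the finite index sets I_x are pairwise disjoint. Set n = max_{x ∈ X, i ∈ I_x} ‖P_i‖, ℓ = max_{x ∈ X, i ∈ I_x} ‖C_i‖, p = max_{x ∈ X} |I_x|, q = ⌈log₂ |X|⌉, and a_k = 4^{k+1} k^{k/2}. Then there exists an index set J with |J| ≤ p^{2^q} (ℓ+1)^{k·2^{q+1}} (a_k n + 1)^{4(3k+2)^{q+1}} such that for each j ∈ J there are finite sets P_j, C_j ⊆ ℕ^k with ‖P_j‖ ≤ (a_k n)^{(3k+1)^q} and ‖C_j‖ ≤ (a_k n + 1)^{(3k+2)^q} · ℓ, and ⋂_{x ∈ X} (⋃_{i ∈ I_x} L(C_i, P_i)) = ⋃_{j ∈ J} L(C_j, P_j). -/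

import Mathlib

/-- Maximum norm of a vector in `ℕ^k`. -/
def vnorm {k : ℕ} (x : Fin k → ℕ) : ℕ := Finset.univ.sup x

/-- Maximum norm of a finite set of vectors in `ℕ^k` (`0` for the empty set). -/
def snorm {k : ℕ} (P : Finset (Fin k → ℕ)) : ℕ := P.sup vnorm

/-- The set `L(C,P) = { c + ∑_{x ∈ P} λ_x • x : c ∈ C, λ_x ∈ ℕ }`. -/
def LSet {k : ℕ} (C P : Finset (Fin k → ℕ)) : Set (Fin k → ℕ) :=
  {v | ∃ c ∈ C, ∃ lam : (Fin k → ℕ) → ℕ, v = c + ∑ x ∈ P, lam x • x}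

/-- The linear set `L(c,P)` with a single constant vector `c`. -/
def LSet1 {k : ℕ} (c : Fin k → ℕ) (P : Finset (Fin k → ℕ)) : Set (Fin k → ℕ) :=
  LSet {c} P

/-- A finite set of vectors of `ℕ^k` is linearly independent if its elements,
viewed as vectors in `ℚ^k`, are linearly independent. -/
def LinIndep {k : ℕ} (P : Finset (Fin k → ℕ)) : Prop :=
  LinearIndependent ℚ (fun x : P => fun i => ((x : Fin k → ℕ) i : ℚ))


theorem vertex_aux {α D : Type*} [Fintype D] [DecidableEq α] (S : Finset α) (v : α → D → ℝ) (g : ℕ) :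
    ∀ w : α → ℝ, (∀ i ∈ S, 0 ≤ w i ∧ w i ≤ 1) → (∀ t, ∑ i ∈ S, w i * v i t = 0) →
      ∑ i ∈ S, (1 - w i) = Fintype.card D + 1 → (S.filter (fun i => w i < 1)).card ≤ g →
      ∃ w' : α → ℝ, (∀ i ∈ S, 0 ≤ w' i ∧ w' i ≤ 1) ∧ (∀ t, ∑ i ∈ S, w' i * v i t = 0) ∧
        ∑ i ∈ S, (1 - w' i) = Fintype.card D + 1 ∧ ∃ i ∈ S, w' i = 0 := by
  induction g with
  | zero =>
    intro w h1 h2 h3 h4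
    exfalso
    have h5 : S.filter (fun i => w i < 1) = ∅ := by simpa using h4
    have : ∑ i ∈ S, (1 - w i) = 0 := by
      apply Finset.sum_eq_zero
      intro i hi
      have : ¬ w i < 1 := fun h => by
        have : i ∈ S.filter (fun i => w i < 1) := by simp [hi, h]
        rw [h5] at this; simp at this
      linarith [(h1 i hi).2]
    rw [this] at h3
    have : (0:ℝ) ≤ Fintype.card D := by positivity
    linarith
  | succ g ih =>
    intro w h1 h2 h3 h4
    by_cases hz : ∃ i ∈ S, w i = 0
    · exact ⟨w, h1, h2, h3, hz⟩
    push Not at hz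
    set G := S.filter (fun i => w i < 1) with hG
    have hpos : ∀ i ∈ S, 0 < w i := fun i hi => lt_of_le_of_ne (h1 i hi).1 (Ne.symm (hz i hi))
    have hGs : ∑ i ∈ G, (1 - w i) = Fintype.card D + 1 := by
      rw [← h3]
      apply Finset.sum_subset (Finset.filter_subset _ _)
      intro i hi hni
      have : ¬ w i < 1 := fun h => hni (by simp [G, hi, h])
      linarith [(h1 i hi).2]
    have hGne : G.Nonempty := by
      rw [Finset.nonempty_iff_ne_empty]
      intro h
      rw [h] at hGs
      have : (0:ℝ) ≤ Fintype.card D := by positivity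
      simp at hGs
      linarith
    have hGS : ∀ i ∈ G, i ∈ S := fun i hi => (Finset.mem_filter.1 hi).1
    have hG1 : ∀ i ∈ G, w i < 1 := fun i hi => (Finset.mem_filter.1 hi).2
    have hcard : Fintype.card D + 1 < G.card := by
      have : ∑ i ∈ G, (1 - w i) < ∑ i ∈ G, (1:ℝ) :=
        Finset.sum_lt_sum_of_nonempty hGne (fun i hi => by linarith [hpos i (hGS i hi)])
      rw [hGs] at this
      simp at this
      exact_mod_cast this
    -- kernel vector
    have hker : ∃ u : α → ℝ, (∀ t, ∑ i ∈ G, u i * v i t = 0) ∧ ∑ i ∈ G, u i = 0 ∧ ∃ i ∈ G, u i ≠ 0 := by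
      have hnl : ¬ LinearIndependent ℝ (fun i : G => ((v i, 1) : (D → ℝ) × ℝ)) := by
        intro h
        have := h.fintype_card_le_finrank
        simp at this
        omega
      rw [Fintype.not_linearIndependent_iff] at hnl
      obtain ⟨u, hu, ⟨i, hi⟩, hui⟩ := hnl
      refine ⟨fun i => if h : i ∈ G then u ⟨i, h⟩ else 0, ?_, ?_, i, hi, by simpa [hi] using hui⟩
      · intro t
        rw [← Finset.sum_coe_sort]
        have := congrArg (fun p => p.1 t) hu
        simpa [Prod.fst_sum] using this
      · rw [← Finset.sum_coe_sort]
        have := congrArg (fun p => p.2) hu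
        simpa [Prod.snd_sum] using this
    obtain ⟨u, hu1, hu2, i0, hi0, hui0⟩ := hker
    let r : α → ℝ := fun i => if 0 < u i then (1 - w i) / u i else w i / (- u i)
    obtain ⟨j, hj, hmin⟩ := Finset.exists_min_image (G.filter (fun i => u i ≠ 0)) r
      ⟨i0, by simp [hi0, hui0]⟩
    have hjG : j ∈ G := (Finset.mem_filter.1 hj).1
    have huj : u j ≠ 0 := (Finset.mem_filter.1 hj).2
    have hr0 : 0 ≤ r j := by
      dsimp only [r]
      split_ifs with h
      · exact div_nonneg (by linarith [hG1 j hjG]) h.le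
      · exact div_nonneg (hpos j (hGS j hjG)).le (by linarith)
    let w' : α → ℝ := fun i => if i ∈ G then w i + r j * u i else w i
    have hw'b : ∀ i ∈ S, 0 ≤ w' i ∧ w' i ≤ 1 := by
      intro i hi
      by_cases hiG : i ∈ G
      swap
      · simpa [w', hiG] using h1 i hi
      simp only [w', hiG, if_true]
      by_cases hui : u i = 0
      · simpa [hui] using h1 i hi
      have hm := hmin i (by simp [hiG, hui])
      rcases lt_or_gt_of_ne hui with h | h
      · have hri : r i = w i / (- u i) := by simp [r, not_lt.2 h.le]
        rw [hri, le_div_iff₀ (by linarith)] at hm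
        have : r j * u i ≤ 0 := mul_nonpos_of_nonneg_of_nonpos hr0 h.le
        constructor
        · linarith
        · linarith [(h1 i hi).2]
      · have hri : r i = (1 - w i) / u i := by simp [r, h]
        rw [hri, le_div_iff₀ h] at hm
        have : 0 ≤ r j * u i := mul_nonneg hr0 h.le
        constructor
        · linarith [(h1 i hi).1]
        · linarith
    have hsplit : ∀ f : α → ℝ, ∑ i ∈ S, w' i * f i = ∑ i ∈ S, w i * f i + r j * ∑ i ∈ G, u i * f i := by
      intro f
      have : ∀ i ∈ S, w' i * f i = w i * f i + (if i ∈ G then r j * (u i * f i) else 0) := by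
        intro i _
        dsimp only [w']
        split_ifs <;> ring
      rw [Finset.sum_congr rfl this, Finset.sum_add_distrib, Finset.mul_sum]
      congr 1
      rw [Finset.sum_ite_mem, Finset.inter_eq_right.2 (Finset.filter_subset _ _)]
    have hw'2 : ∀ t, ∑ i ∈ S, w' i * v i t = 0 := by
      intro t
      rw [hsplit (fun i => v i t), h2, hu1]; simp
    have hw'3 : ∑ i ∈ S, (1 - w' i) = Fintype.card D + 1 := by
      have := hsplit (fun _ => 1)
      simp only [mul_one] at this
      rw [Finset.sum_sub_distrib, this, hu2, ← h3, Finset.sum_sub_distrib]; ring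
    rcases lt_or_gt_of_ne huj with h | h
    · refine ⟨w', hw'b, hw'2, hw'3, j, hGS j hjG, ?_⟩
      have hri : r j = w j / (- u j) := by simp [r, not_lt.2 h.le]
      simp only [w', hjG, if_true, hri]
      field_simp
      ring
    · apply ih w' hw'b hw'2 hw'3
      have hlt : (S.filter (fun i => w' i < 1)) ⊂ G := by
        rw [Finset.ssubset_iff_of_subset]
        · refine ⟨j, hjG, ?_⟩
          have hri : r j = (1 - w j) / u j := by simp [r, h]
          have : w' j = 1 := by
            simp only [w', hjG, if_true, hri]
            field_simp
            ring
          simp [this]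
        · intro i hi
          by_contra hiG
          rw [Finset.mem_filter] at hi
          simp only [w', hiG, if_false] at hi
          exact hiG (Finset.mem_filter.2 hi)
      have := Finset.card_lt_card hlt
      omega

theorem steinitz_aux {α D : Type*} [Fintype D] [DecidableEq α] (v : α → D → ℝ) (n : ℝ)
    (hn : 0 ≤ n) (hv : ∀ i t, |v i t| ≤ n) : ∀ (m : ℕ) (S : Finset α), S.card = m →
    (m ≤ Fintype.card D ∨ ∃ w : α → ℝ, (∀ i ∈ S, 0 ≤ w i ∧ w i ≤ 1) ∧
      (∀ t, ∑ i ∈ S, w i * v i t = 0) ∧ ∑ i ∈ S, (1 - w i) = Fintype.card D) →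
    ∃ A : ℕ → Finset α, A m = S ∧ Monotone A ∧ (∀ j ≤ m, (A j).card = j) ∧
      ∀ j ≤ m, ∀ t, |∑ i ∈ A j, v i t| ≤ Fintype.card D * n := by
  intro m
  induction m with
  | zero =>
    intro S hS _
    refine ⟨fun _ => S, rfl, monotone_const, by simp [hS], ?_⟩
    intro j _ t
    rw [Finset.card_eq_zero.1 hS]
    simp; positivity
  | succ m ih =>
    intro S hS hor
    have hSb : ∀ t, |∑ i ∈ S, v i t| ≤ Fintype.card D * n := by
      intro t
      rcases hor with h | ⟨w, hw1, hw2, hw3⟩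
      · calc |∑ i ∈ S, v i t| ≤ ∑ i ∈ S, |v i t| := Finset.abs_sum_le_sum_abs _ _
          _ ≤ ∑ i ∈ S, n := Finset.sum_le_sum (fun i _ => hv i t)
          _ = S.card * n := by simp
          _ ≤ _ := by
            rw [hS]; gcongr
      · have : ∑ i ∈ S, v i t = ∑ i ∈ S, (1 - w i) * v i t := by
          have := hw2 t
          simp only [sub_mul, one_mul, Finset.sum_sub_distrib, this, sub_zero]
        rw [this, ← hw3, Finset.sum_mul]
        refine (Finset.abs_sum_le_sum_abs _ _).trans (Finset.sum_le_sum fun i hi => ?_)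
        have h1 : 0 ≤ 1 - w i := by linarith [(hw1 i hi).2]
        rw [abs_mul, abs_of_nonneg h1]
        exact mul_le_mul_of_nonneg_left (hv i t) h1
    have hstep : ∃ i ∈ S, (m ≤ Fintype.card D ∨ ∃ w : α → ℝ, (∀ j ∈ S.erase i, 0 ≤ w j ∧ w j ≤ 1) ∧
      (∀ t, ∑ j ∈ S.erase i, w j * v j t = 0) ∧ ∑ j ∈ S.erase i, (1 - w j) = Fintype.card D) := by
      by_cases hle : m + 1 ≤ Fintype.card D
      · obtain ⟨i, hi⟩ : S.Nonempty := by rw [← Finset.card_pos]; omega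
        exact ⟨i, hi, Or.inl (by omega)⟩
      obtain ⟨w, hw1, hw2, hw3⟩ := hor.resolve_left hle
      have hmd : (Fintype.card D : ℝ) ≤ m := by exact_mod_cast (by omega : Fintype.card D ≤ m)
      set s : ℝ := (m - Fintype.card D) / (m + 1 - Fintype.card D) with hs
      have hs0 : 0 ≤ s := div_nonneg (by linarith) (by linarith)
      have hs1 : s ≤ 1 := by rw [hs, div_le_one (by linarith)]; linarith
      have hsum : ∑ i ∈ S, w i = m + 1 - Fintype.card D := by
        rw [Finset.sum_sub_distrib] at hw3
        simp [hS] at hw3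
        linarith
      obtain ⟨w', a1, a2, a3, i, hi, hi0⟩ := vertex_aux S v _ (fun i => s * w i) (by
          intro i hi
          exact ⟨mul_nonneg hs0 (hw1 i hi).1, mul_le_one₀ hs1 (hw1 i hi).1 (hw1 i hi).2⟩) (by
          intro t
          simp only [mul_assoc]
          rw [← Finset.mul_sum, hw2, mul_zero]) (by
          rw [Finset.sum_sub_distrib, ← Finset.mul_sum, hsum, hs,
            div_mul_cancel₀ _ (by linarith)]
          simp [hS]; ring) le_rfl
      refine ⟨i, hi, Or.inr ⟨w', fun j hj => a1 j (Finset.mem_of_mem_erase hj), ?_, ?_⟩⟩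
      · intro t
        have := a2 t
        rw [← Finset.add_sum_erase S _ hi, hi0] at this
        simpa using this
      · rw [← Finset.add_sum_erase S _ hi, hi0] at a3
        linarith
    obtain ⟨i, hi, hor'⟩ := hstep
    obtain ⟨A, hA1, hA2, hA3, hA4⟩ := ih (S.erase i) (by rw [Finset.card_erase_of_mem hi]; omega) hor'
    refine ⟨fun j => if j ≤ m then A j else S, by simp, ?_, ?_, ?_⟩
    · intro a b hab
      by_cases hb : b ≤ m
      · simp only [hb, hab.trans hb, if_true]; exact hA2 hab
      · simp only [hb, if_false]
        split_ifs with ha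
        · exact (hA2 ha).trans (hA1 ▸ Finset.erase_subset _ _)
        · exact le_rfl
    · intro j hj
      by_cases h : j ≤ m
      · simpa [h] using hA3 j h
      · simp only [h, if_false]; omega
    · intro j hj t
      by_cases h : j ≤ m
      · simpa [h] using hA4 j h t
      · simpa [h] using hSb t

theorem steinitz {α D : Type*} [Fintype D] [DecidableEq α] (v : α → D → ℤ) (n : ℕ)
    (hv : ∀ i t, |v i t| ≤ n) (S : Finset α) (h0 : ∀ t, ∑ i ∈ S, v i t = 0) :
    ∃ A : ℕ → Finset α, A S.card = S ∧ Monotone A ∧ (∀ j ≤ S.card, (A j).card = j) ∧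
      ∀ j ≤ S.card, ∀ t, |∑ i ∈ A j, v i t| ≤ Fintype.card D * n := by
  obtain ⟨A, h1, h2, h3, h4⟩ := steinitz_aux (fun i t => (v i t : ℝ)) n (by positivity)
    (fun i t => by exact_mod_cast hv i t) S.card S rfl (by
      by_cases h : S.card ≤ Fintype.card D
      · exact Or.inl h
      right
      push Not at h
      have h' : (Fintype.card D : ℝ) < S.card := by exact_mod_cast h
      have hp : (0:ℝ) < S.card := lt_of_le_of_lt (by positivity) h'
      refine ⟨fun _ => 1 - Fintype.card D / S.card, fun i _ => ⟨?_, ?_⟩, ?_, ?_⟩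
      · rw [sub_nonneg, div_le_one hp]; exact h'.le
      · have : 0 ≤ (Fintype.card D : ℝ) / S.card := by positivity
        linarith
      · intro t
        rw [← Finset.mul_sum]
        have : (∑ i ∈ S, (v i t : ℝ)) = 0 := by exact_mod_cast h0 t
        rw [this, mul_zero]
      · simp
        field_simp)
  exact ⟨A, h1, h2, h3, fun j hj t => by exact_mod_cast h4 j hj t⟩

/-- Pigeonhole: a long zero-sum family has a proper zero-sum subfamily avoiding `B`. -/
theorem zero_sum_sub {α D : Type*} [Fintype D] [DecidableEq α] (v : α → D → ℤ) (n : ℕ)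
    (hv : ∀ i t, |v i t| ≤ n) (S B : Finset α) (h0 : ∀ t, ∑ i ∈ S, v i t = 0)
    (hcard : (2 * Fintype.card D * n + 1) ^ Fintype.card D * (B.card + 1) < S.card) :
    ∃ T ⊆ S, T.Nonempty ∧ T ≠ S ∧ Disjoint T B ∧ ∀ t, ∑ i ∈ T, v i t = 0 := by
  classical
  obtain ⟨A, h1, h2, h3, h4⟩ := steinitz v n hv S h0
  let M : ℤ := Fintype.card D * n
  let tgt : Finset ((D → ℤ) × ℕ) :=
    (Fintype.piFinset fun _ : D => Finset.Icc (-M) M) ×ˢ Finset.range (B.card + 1)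
  have htgt : tgt.card = (2 * Fintype.card D * n + 1) ^ Fintype.card D * (B.card + 1) := by
    simp only [tgt, Finset.card_product, Fintype.card_piFinset, Finset.card_range, Int.card_Icc,
      Finset.prod_const, Finset.card_univ]
    congr 2
    simp only [M]
    have : ((Fintype.card D : ℤ) * n + 1 - -(Fintype.card D * n)) = ((2 * Fintype.card D * n + 1 : ℕ) : ℤ) := by
      push_cast; ring
    rw [this, Int.toNat_natCast]
  obtain ⟨a, ha, b, hb, hab, hf⟩ := Finset.exists_ne_map_eq_of_card_lt_of_maps_to
    (s := Finset.range S.card) (t := tgt)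
    (by rw [htgt]; simpa using hcard)
    (f := fun j => ((fun t => ∑ i ∈ A j, v i t), (A j ∩ B).card)) (by
      intro j hj
      simp only [Finset.coe_range, Set.mem_Iio] at hj
      simp only [tgt, Finset.coe_product, Set.mem_prod, Finset.mem_coe, Fintype.mem_piFinset,
        Finset.mem_Icc, Finset.mem_range]
      refine ⟨fun t => abs_le.1 (h4 j hj.le t), ?_⟩
      have := Finset.card_le_card (Finset.inter_subset_right : A j ∩ B ⊆ B)
      omega)
  wlog hlt : a < b generalizing a b
  · exact this b hb a ha hab.symm hf.symm (by omega)
  simp only [Finset.mem_range] at ha hb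
  simp only [Prod.mk.injEq] at hf
  have hsub : A a ⊆ A b := h2 hlt.le
  have hbS : A b ⊆ S := h1 ▸ h2 hb.le
  have hc : (A b \ A a).card = b - a := by
    rw [Finset.card_sdiff_of_subset hsub, h3 _ ha.le, h3 _ hb.le]
  refine ⟨A b \ A a, Finset.sdiff_subset.trans hbS, ?_, ?_, ?_, ?_⟩
  · rw [← Finset.card_pos]; omega
  · intro h
    rw [h] at hc
    omega
  · have : A a ∩ B = A b ∩ B :=
      Finset.eq_of_subset_of_card_le (Finset.inter_subset_inter_right hsub) hf.2.ge
    rw [Finset.disjoint_left]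
    intro i hi hiB
    rw [Finset.mem_sdiff] at hi
    have h : i ∈ A b ∩ B := Finset.mem_inter.2 ⟨hi.1, hiB⟩
    rw [← this] at h
    exact hi.2 (Finset.mem_inter.1 h).1
  · intro t
    have e := congrFun hf.1 t
    have := Finset.sum_sdiff (f := fun i => v i t) hsub
    linarith

/-- Splitting of solutions of integer programs. -/
theorem ip_split {E D : Type*} [Fintype E] [Fintype D] (a : E → D → ℤ) (n ℓ : ℕ) (hn : 1 ≤ n)
    (ha : ∀ e t, |a e t| ≤ n) (z : E → ℕ) (b : D → ℕ) (hb : ∀ t, b t ≤ ℓ)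
    (hz : ∀ t, ∑ e, (z e : ℤ) * a e t = b t)
    (hbig : (2 * Fintype.card D * n + 1) ^ Fintype.card D * (ℓ + 1) < ∑ e, z e) :
    ∃ z' : E → ℕ, z' ≤ z ∧ z' ≠ 0 ∧ (ℓ = 0 → z' ≠ z) ∧ ∀ t, ∑ e, (z' e : ℤ) * a e t = 0 := by
  classical
  let α := (Σ e : E, Fin (z e)) ⊕ Fin ℓ
  let v : α → D → ℤ := Sum.elim (fun s t => a s.1 t) (fun j t => if (j : ℕ) < b t then -1 else 0)
  have hv : ∀ i t, |v i t| ≤ n := by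
    rintro (⟨e, _⟩ | j) t
    · exact ha e t
    · have : (1:ℤ) ≤ n := by exact_mod_cast hn
      simp only [v, Sum.elim_inr]
      split_ifs <;> simp
      exact hn
  obtain ⟨T, -, hT1, hT2, hT3, hT4⟩ := zero_sum_sub v n hv Finset.univ
    (Finset.univ.map Function.Embedding.inr) (by
      intro t
      rw [Fintype.sum_sum_type]
      simp only [v, Sum.elim_inl, Sum.elim_inr]
      rw [Fintype.sum_sigma]
      simp only [Finset.sum_const, Finset.card_univ, Fintype.card_fin, nsmul_eq_mul]
      rw [hz]
      have : ∑ j : Fin ℓ, (if (j : ℕ) < b t then (-1 : ℤ) else 0) = - b t := by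
        rw [Fin.sum_univ_eq_sum_range (fun j => if j < b t then (-1:ℤ) else 0) ℓ, ← Finset.sum_filter]
        have : (Finset.range ℓ).filter (fun j => j < b t) = Finset.range (b t) := by
          ext j; simp; intro h; exact h.trans_le (hb t)
        rw [this]; simp
      rw [this]; ring) (by
      simp only [Finset.card_map, Finset.card_univ, Fintype.card_fin]
      rw [Fintype.card_sum, Fintype.card_sigma]
      simp only [Fintype.card_fin]
      omega)
  have hinl : ∀ i ∈ T, ∃ s, i = Sum.inl s := by
    rintro (s | j) hi
    · exact ⟨s, rfl⟩
    · exact absurd (Finset.mem_map.2 ⟨j, Finset.mem_univ _, rfl⟩) (Finset.disjoint_left.1 hT3 hi)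
  have hsumT : ∀ t, ∑ e, (((Finset.univ.filter (fun f : Fin (z e) => (Sum.inl ⟨e, f⟩ : α) ∈ T)).card : ℕ) : ℤ)
      * a e t = 0 := by
    intro t
    rw [← hT4 t]
    have h1 : ∑ i ∈ T, v i t = ∑ i : α, if i ∈ T then v i t else 0 := by simp
    rw [h1, Fintype.sum_sum_type, Fintype.sum_sigma]
    have h2 : ∑ j : Fin ℓ, (if (Sum.inr j : α) ∈ T then v (Sum.inr j) t else 0) = 0 := by
      apply Finset.sum_eq_zero
      intro j _
      rw [if_neg]
      intro hj
      obtain ⟨s, hs⟩ := hinl _ hj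
      cases hs
    rw [h2, add_zero]
    apply Finset.sum_congr rfl
    intro e _
    simp only [v, Sum.elim_inl]
    rw [← Finset.sum_filter, Finset.sum_const, nsmul_eq_mul]
  refine ⟨fun e => (Finset.univ.filter (fun f : Fin (z e) => (Sum.inl ⟨e, f⟩ : α) ∈ T)).card,
    ?_, ?_, ?_, hsumT⟩
  · intro e
    refine (Finset.card_le_univ _).trans ?_
    simp
  · intro h
    obtain ⟨i, hi⟩ := hT1
    obtain ⟨⟨e, f⟩, rfl⟩ := hinl i hi
    have := congrFun h e
    simp only [Pi.zero_apply, Finset.card_eq_zero] at this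
    have hm : f ∈ (Finset.univ.filter (fun f : Fin (z e) => (Sum.inl ⟨e, f⟩ : α) ∈ T)) := by
      simpa using hi
    rw [this] at hm
    simp at hm
  · intro hl h
    subst hl
    apply hT2
    rw [Finset.eq_univ_iff_forall]
    rintro (⟨e, f⟩ | j)
    · have := congrFun h e
      have h2 : (Finset.univ.filter (fun f : Fin (z e) => (Sum.inl ⟨e, f⟩ : α) ∈ T)) = Finset.univ := by
        rw [← Finset.card_eq_iff_eq_univ]; simpa using this
      have h3 := Finset.mem_univ f
      rw [← h2] at h3
      simpa using h3
    · exact j.elim0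

theorem sum_smul_zero {k : ℕ} (Q : Finset (Fin k → ℕ)) (hQ : 0 ∉ Q) (w : (Fin k → ℕ) → ℕ)
    (h : ∑ y ∈ Q, w y • y = 0) : ∀ y ∈ Q, w y = 0 := by
  intro y hy
  have h1 := (Finset.sum_eq_zero_iff.1 h) y hy
  rcases smul_eq_zero.1 h1 with h | h
  · exact h
  · exact absurd (h ▸ hy) hQ

theorem le_vnorm {k : ℕ} (v : Fin k → ℕ) (i : Fin k) : v i ≤ vnorm v :=
  Finset.le_sup (f := v) (Finset.mem_univ i)

theorem le_snorm {k : ℕ} (P : Finset (Fin k → ℕ)) (v : Fin k → ℕ) (h : v ∈ P) (i : Fin k) :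
    v i ≤ snorm P :=
  (le_vnorm v i).trans (Finset.le_sup (f := vnorm) h)

theorem lin_split {k : ℕ} {χ : Type*} [Fintype χ] (P : χ → Finset (Fin k → ℕ))
    (c : χ → Fin k → ℕ) (n ℓ : ℕ) (hn : 1 ≤ n) (hP : ∀ x, snorm (P x) ≤ n)
    (hc : ∀ x i, c x i ≤ ℓ) (v : Fin k → ℕ) (hv : ∀ x, v ∈ LSet {c x} (P x))
    (hbig : (2 * (Fintype.card χ * k) * n + 1) ^ (Fintype.card χ * k) * (ℓ + 1) < ∑ i, v i) :
    ∃ h u, v = h + u ∧ h ≠ 0 ∧ (ℓ = 0 → u ≠ 0) ∧ (∀ x, h ∈ LSet {0} (P x)) ∧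
      ∀ x, u ∈ LSet {c x} (P x) := by
  classical
  have hv' : ∀ x, ∃ lam : (Fin k → ℕ) → ℕ, v = c x + ∑ y ∈ (P x).erase 0, lam y • y := by
    intro x
    obtain ⟨c', hc', lam, hl⟩ := hv x
    rw [Finset.mem_singleton] at hc'
    subst hc'
    exact ⟨lam, by rw [Finset.sum_erase _ (by simp)]; exact hl⟩
  choose lam hlam using hv'
  let E := Fin k ⊕ (Σ x : χ, {y // y ∈ (P x).erase 0})
  let a : E → χ × Fin k → ℤ := Sum.elim (fun i t => if t.2 = i then 1 else 0)
    (fun s t => if t.1 = s.1 then -((s.2.1 t.2 : ℕ) : ℤ) else 0)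
  let z : E → ℕ := Sum.elim v (fun s => lam s.1 s.2.1)
  have hsum : ∀ (z : E → ℕ) (t : χ × Fin k), ∑ e, (z e : ℤ) * a e t =
      z (Sum.inl t.2) - ∑ y : {y // y ∈ (P t.1).erase 0}, (z (Sum.inr ⟨t.1, y⟩) : ℤ) * (y.1 t.2 : ℕ) := by
    rintro z ⟨x, i⟩
    rw [Fintype.sum_sum_type, Fintype.sum_sigma]
    simp only [a, Sum.elim_inl, Sum.elim_inr]
    rw [Finset.sum_eq_single i (by intro j _ hj; simp [Ne.symm hj]) (by simp),
      Finset.sum_eq_single x (by intro j _ hj; simp [Ne.symm hj]) (by simp)]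
    simp [Finset.sum_neg_distrib, sub_eq_add_neg]
  obtain ⟨z', hz1, hz2, hz3, hz4⟩ := ip_split a n ℓ hn (by
      rintro (i | ⟨x, y, hy⟩) t
      · simp only [a, Sum.elim_inl]
        split_ifs
        · simpa using hn
        · simp
      · simp only [a, Sum.elim_inr]
        split_ifs
        · simp only [abs_neg, Nat.abs_cast]
          exact_mod_cast (le_snorm (P x) y (Finset.mem_of_mem_erase hy) _).trans (hP x)
        · simp) z (fun t => c t.1 t.2) (fun t => hc _ _) (by
      rintro ⟨x, i⟩
      rw [hsum]
      simp only [z, Sum.elim_inl, Sum.elim_inr]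
      rw [Finset.sum_coe_sort ((P x).erase 0) (fun y => (lam x y : ℤ) * (y i : ℕ))]
      have := congrFun (hlam x) i
      simp only [Pi.add_apply, Finset.sum_apply, Pi.smul_apply, smul_eq_mul] at this
      rw [this]
      push_cast
      ring) (by
      rw [Fintype.card_prod, Fintype.card_fin, Fintype.sum_sum_type]
      simp only [z, Sum.elim_inl]
      exact lt_of_lt_of_le hbig (Nat.le_add_right _ _))
  let h : Fin k → ℕ := fun i => z' (Sum.inl i)
  let mu : χ → (Fin k → ℕ) → ℕ := fun x y =>
    if hy : y ∈ (P x).erase 0 then z' (Sum.inr ⟨x, y, hy⟩) else 0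
  have hmu : ∀ x, h = ∑ y ∈ (P x).erase 0, mu x y • y := by
    intro x
    ext i
    have := hz4 (x, i)
    rw [hsum] at this
    simp only [Finset.sum_apply, Pi.smul_apply, smul_eq_mul]
    rw [← Finset.sum_coe_sort]
    simp only [mu, Finset.coe_mem, dite_true, h]
    have h2 := sub_eq_zero.1 this
    exact_mod_cast h2
  have hmule : ∀ x, ∀ y ∈ (P x).erase 0, mu x y ≤ lam x y := by
    intro x y hy
    simp only [mu, hy, dite_true]
    exact hz1 (Sum.inr ⟨x, y, hy⟩)
  have hle : h ≤ v := fun i => hz1 (Sum.inl i)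
  have hu : ∀ x, v - h = c x + ∑ y ∈ (P x).erase 0, (lam x y - mu x y) • y := by
    intro x
    have e : ∑ y ∈ (P x).erase 0, lam x y • y =
        ∑ y ∈ (P x).erase 0, (lam x y - mu x y) • y + h := by
      rw [hmu x, ← Finset.sum_add_distrib]
      refine Finset.sum_congr rfl fun y hy => ?_
      rw [← add_smul, Nat.sub_add_cancel (hmule x y hy)]
    have e2 := hlam x
    rw [e] at e2
    rw [e2, ← add_assoc, add_tsub_cancel_right]
  refine ⟨h, v - h, (add_tsub_cancel_of_le hle).symm, ?_, ?_, ?_, ?_⟩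
  · intro h0
    apply hz2
    ext e
    rcases e with i | ⟨x, y, hy⟩
    · exact congrFun h0 i
    · have := sum_smul_zero _ (by simp) (mu x) ((hmu x).symm.trans h0) y hy
      simp only [mu, hy, dite_true] at this
      exact this
  · intro hl h0
    apply hz3 hl
    have hvh : v = h := le_antisymm (tsub_eq_zero_iff_le.1 h0) hle
    ext e
    rcases e with i | ⟨x, y, hy⟩
    · exact (congrFun hvh i).symm
    · have h1 := hu x
      rw [h0] at h1
      have h2 : ∑ y ∈ (P x).erase 0, (lam x y - mu x y) • y = 0 :=
        (add_eq_zero.1 h1.symm).2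
      have h3 := sum_smul_zero _ (by simp) (fun y => lam x y - mu x y) h2 y hy
      have h4 := hmule x y hy
      have h5 : mu x y = lam x y := by omega
      simp only [mu, hy, dite_true] at h5
      exact h5
  · intro x
    refine ⟨0, by simp, mu x, ?_⟩
    rw [zero_add, hmu x, Finset.sum_erase _ (by simp)]
  · intro x
    refine ⟨c x, by simp, fun y => lam x y - mu x y, ?_⟩
    rw [hu x, Finset.sum_erase _ (by simp)]

theorem mem_LSet_iff {k : ℕ} (C P : Finset (Fin k → ℕ)) (v : Fin k → ℕ) :
    v ∈ LSet C P ↔ ∃ c ∈ C, ∃ h ∈ AddSubmonoid.closure (P : Set (Fin k → ℕ)), v = c + h := by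
  constructor
  · rintro ⟨c, hc, lam, rfl⟩
    exact ⟨c, hc, _, sum_mem fun y hy => AddSubmonoid.nsmul_mem _
      (AddSubmonoid.subset_closure hy) _, rfl⟩
  · rintro ⟨c, hc, h, hh, rfl⟩
    obtain ⟨f, -, hf⟩ := AddSubmonoid.mem_closure_finset.1 hh
    exact ⟨c, hc, f, by rw [hf]⟩

theorem mem_LSet_zero_iff {k : ℕ} (P : Finset (Fin k → ℕ)) (v : Fin k → ℕ) :
    v ∈ LSet {0} P ↔ v ∈ AddSubmonoid.closure (P : Set (Fin k → ℕ)) := by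
  rw [mem_LSet_iff]; simp

theorem vnorm_le_sum {k : ℕ} (v : Fin k → ℕ) : vnorm v ≤ ∑ i, v i :=
  Finset.sup_le fun i hi => Finset.single_le_sum (f := v) (fun _ _ => Nat.zero_le _) hi

theorem sum_pos_of_ne {k : ℕ} (v : Fin k → ℕ) (h : v ≠ 0) : 0 < ∑ i, v i := by
  rw [pos_iff_ne_zero]
  intro h0
  apply h
  ext i
  exact (Finset.sum_eq_zero_iff.1 h0) i (Finset.mem_univ i)

theorem exists_finset_norm {k : ℕ} (N : ℕ) (Q : (Fin k → ℕ) → Prop) :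
    ∃ F : Finset (Fin k → ℕ), ∀ v, v ∈ F ↔ vnorm v ≤ N ∧ Q v := by
  classical
  refine ⟨(Fintype.piFinset fun _ => Finset.range (N + 1)).filter Q, fun v => ?_⟩
  simp only [Finset.mem_filter, Fintype.mem_piFinset, Finset.mem_range, vnorm, Finset.sup_le_iff,
    Finset.mem_univ, true_implies, Nat.lt_succ_iff]

theorem inter_family {k : ℕ} {χ : Type*} [Fintype χ] (C P : χ → Finset (Fin k → ℕ))
    (n ℓ N : ℕ) (hn : 1 ≤ n) (hP : ∀ x, snorm (P x) ≤ n) (hC : ∀ x, snorm (C x) ≤ ℓ)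
    (hN : N = (2 * (Fintype.card χ * k) * n + 1) ^ (Fintype.card χ * k)) :
    ∃ C' P' : Finset (Fin k → ℕ), snorm P' ≤ N ∧ snorm C' ≤ N * (2 * ℓ) ∧
      (⋂ x, LSet (C x) (P x)) = LSet C' P' := by
  obtain ⟨P', hP'⟩ := exists_finset_norm (k := k) N (fun v => ∀ x, v ∈ LSet {0} (P x))
  obtain ⟨C', hC'⟩ := exists_finset_norm (k := k) (N * (2 * ℓ)) (fun v => ∀ x, v ∈ LSet (C x) (P x))
  have claim1 : ∀ (s : ℕ) (v : Fin k → ℕ), ∑ i, v i = s → (∀ x, v ∈ LSet {0} (P x)) →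
      v ∈ AddSubmonoid.closure (P' : Set (Fin k → ℕ)) := by
    intro s
    induction s using Nat.strong_induction_on with
    | _ s ih =>
      intro v hs hv
      by_cases hb : vnorm v ≤ N
      · exact AddSubmonoid.subset_closure ((hP' v).2 ⟨hb, hv⟩)
      obtain ⟨h, u, rfl, h0, u0, hh, hu⟩ := lin_split P (fun _ => 0) n 0 hn hP (by simp) v hv (by
        rw [← hN, zero_add, mul_one]
        exact lt_of_lt_of_le (not_le.1 hb) (vnorm_le_sum v))
      have e : ∑ i, (h + u) i = ∑ i, h i + ∑ i, u i := by simp [Finset.sum_add_distrib]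
      have p1 := sum_pos_of_ne h h0
      have p2 := sum_pos_of_ne u (u0 rfl)
      exact add_mem (ih _ (by omega) h rfl hh) (ih _ (by omega) u rfl hu)
  have claim2 : ∀ (c : χ → Fin k → ℕ), (∀ x, c x ∈ C x) → ∀ (s : ℕ) (v : Fin k → ℕ), ∑ i, v i = s →
      (∀ x, v ∈ LSet {c x} (P x)) → v ∈ LSet C' P' := by
    intro c hc s
    have hcl : ∀ x i, c x i ≤ ℓ := fun x i => (le_snorm _ _ (hc x) i).trans (hC x)
    have hup : ∀ v x, v ∈ LSet {c x} (P x) → v ∈ LSet (C x) (P x) := by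
      rintro v x ⟨c', h1, lam, h2⟩
      rw [Finset.mem_singleton] at h1
      exact ⟨c', h1 ▸ hc x, lam, h2⟩
    induction s using Nat.strong_induction_on with
    | _ s ih =>
      intro v hs hv
      by_cases hb : vnorm v ≤ N * (2 * ℓ)
      · exact ⟨v, (hC' v).2 ⟨hb, fun x => hup v x (hv x)⟩, 0, by simp⟩
      rcases Nat.eq_zero_or_pos ℓ with hl | hl
      · have hc0 : ∀ x, c x = 0 := fun x => by
          ext i
          have := hcl x i
          simp only [Pi.zero_apply]; omega
        rw [mem_LSet_iff]
        refine ⟨0, (hC' 0).2 ⟨by simp [vnorm], fun x => hup 0 x ?_⟩, v, claim1 _ v rfl ?_, by simp⟩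
        · exact ⟨0, by simp [hc0], 0, by simp⟩
        · intro x
          have := hv x
          rwa [hc0] at this
      · obtain ⟨h, u, rfl, h0, -, hh, hu⟩ := lin_split P c n ℓ hn hP hcl v hv (by
          rw [← hN]
          refine lt_of_le_of_lt ?_ (lt_of_lt_of_le (not_le.1 hb) (vnorm_le_sum v))
          exact Nat.mul_le_mul_left _ (by omega))
        have e : ∑ i, (h + u) i = ∑ i, h i + ∑ i, u i := by simp [Finset.sum_add_distrib]
        have p1 := sum_pos_of_ne h h0
        have h1 := ih _ (by omega) u rfl hu
        have h2 := claim1 _ h rfl hh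
        rw [mem_LSet_iff] at h1 ⊢
        obtain ⟨d, hd, g, hg, rfl⟩ := h1
        exact ⟨d, hd, g + h, add_mem hg h2, by abel⟩
  refine ⟨C', P', Finset.sup_le fun v hv => ((hP' v).1 hv).1,
    Finset.sup_le fun v hv => ((hC' v).1 hv).1, ?_⟩
  ext v
  rw [Set.mem_iInter]
  constructor
  · intro hv
    choose c hc lam hl using hv
    exact claim2 c hc _ v rfl fun x => ⟨c x, by simp, lam x, hl x⟩
  · intro hv x
    rw [mem_LSet_iff] at hv
    obtain ⟨c, hc, h, hh, rfl⟩ := hv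
    have hcx := ((hC' c).1 hc).2 x
    have hle : AddSubmonoid.closure (P' : Set (Fin k → ℕ)) ≤
        AddSubmonoid.closure (P x : Set (Fin k → ℕ)) := by
      rw [AddSubmonoid.closure_le]
      intro y hy
      exact (mem_LSet_zero_iff _ _).1 (((hP' y).1 hy).2 x)
    rw [mem_LSet_iff] at hcx ⊢
    obtain ⟨d, hd, g, hg, rfl⟩ := hcx
    exact ⟨d, hd, g + h, add_mem hg (hle hh), by abel⟩

theorem exp_bound (k : ℕ) (hk : 1 ≤ k) (q : ℕ) : q * (k * 2 ^ q) ≤ (3 * k + 1) ^ q := by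
  induction q with
  | zero => simp
  | succ q ih =>
    rcases Nat.eq_zero_or_pos q with h | h
    · subst h; simp; omega
    · calc (q + 1) * (k * 2 ^ (q + 1)) = (2 * (q + 1)) * (k * 2 ^ q) := by ring
        _ ≤ (4 * q) * (k * 2 ^ q) := Nat.mul_le_mul_right _ (by omega)
        _ = 4 * (q * (k * 2 ^ q)) := by ring
        _ ≤ (3 * k + 1) * (3 * k + 1) ^ q := Nat.mul_le_mul (by omega) ih
        _ = _ := by ring

theorem N_bound (k n m q : ℕ) (ak : ℝ) (hn : 1 ≤ n) (hk : 1 ≤ k) (hq : 1 ≤ q) (hm : m ≤ 2 ^ q)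
    (hak : 16 * (k : ℝ) ≤ ak) :
    (((2 * (m * k) * n + 1) ^ (m * k) : ℕ) : ℝ) ≤ (ak * n) ^ (q * (k * 2 ^ q)) := by
  have hn' : (1:ℝ) ≤ n := by exact_mod_cast hn
  have hk' : (1:ℝ) ≤ k := by exact_mod_cast hk
  have hm' : (m:ℝ) ≤ 2 ^ q := by exact_mod_cast hm
  have hkn : (1:ℝ) ≤ k * n := one_le_mul_of_one_le_of_one_le hk' hn'
  have han : 16 * ((k:ℝ) * n) ≤ ak * n := by
    rw [← mul_assoc]; gcongr
  have hbase : 2 * ((m:ℝ) * k) * n + 1 ≤ (ak * n) ^ q := by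
    obtain ⟨r, rfl⟩ := Nat.exists_eq_add_of_le' hq
    have h2 : (1:ℝ) ≤ 2 ^ r := one_le_pow₀ (by norm_num)
    calc 2 * ((m:ℝ) * k) * n + 1 = 2 * m * (k * n) + 1 := by ring
      _ ≤ 2 * 2 ^ (r + 1) * (k * n) + 1 * (k * n) := by gcongr; linarith
      _ = (4 * 2 ^ r + 1) * (k * n) := by ring
      _ ≤ (2 ^ r * 16) * (k * n) := by gcongr; linarith
      _ = 2 ^ r * (16 * (k * n)) := by ring
      _ ≤ (ak * n) ^ r * (ak * n) := by
        have hp : (0:ℝ) ≤ ak * n := by linarith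
        have hp2 : (2:ℝ) ≤ ak * n := by linarith
        exact mul_le_mul (pow_le_pow_left₀ (by norm_num) hp2 r) han (by positivity)
          (pow_nonneg hp r)
      _ = _ := by ring
  push_cast
  calc (2 * ((m:ℝ) * k) * n + 1) ^ (m * k) ≤ (2 * ((m:ℝ) * k) * n + 1) ^ (k * 2 ^ q) := by
        apply pow_le_pow_right₀
        · have : 0 ≤ 2 * ((m:ℝ) * k) * n := by positivity
          linarith
        · rw [mul_comm]; exact Nat.mul_le_mul_left _ hm
    _ ≤ ((ak * n) ^ q) ^ (k * 2 ^ q) := by gcongr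
    _ = _ := by rw [← pow_mul]

theorem ak_bound (k : ℕ) (hk : 1 ≤ k) : 16 * (k : ℝ) ≤ 4 ^ (k + 1) * (k : ℝ) ^ ((k : ℝ) / 2) := by
  have hk' : (1:ℝ) ≤ k := by exact_mod_cast hk
  have h1 : (1:ℝ) ≤ (k : ℝ) ^ ((k : ℝ) / 2) := Real.one_le_rpow hk' (by positivity)
  have h2 : 4 * k ≤ 4 ^ k := by
    obtain ⟨r, rfl⟩ := Nat.exists_eq_add_of_le' hk
    have : r < 4 ^ r := Nat.lt_pow_self (by norm_num)
    rw [pow_succ]; omega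
  have h2' : 4 * (k:ℝ) ≤ 4 ^ k := by exact_mod_cast h2
  calc 16 * (k:ℝ) = 4 * (4 * k) := by ring
    _ ≤ 4 * 4 ^ k := by gcongr
    _ = 4 ^ (k + 1) * 1 := by ring
    _ ≤ _ := by gcongr

/-- Intersection of a family of sets `L(C,P)`, with bounds. -/
theorem inter_family_bound {k : ℕ} (hk : 1 ≤ k) {χ : Type*} [Fintype χ] [Nonempty χ]
    (C P : χ → Finset (Fin k → ℕ)) (n ℓ q : ℕ) (ak : ℝ) (hP : ∀ x, snorm (P x) ≤ n)
    (hC : ∀ x, snorm (C x) ≤ ℓ) (hq : q = Nat.clog 2 (Fintype.card χ)) (hak : 16 * (k : ℝ) ≤ ak) :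
    ∃ C' P' : Finset (Fin k → ℕ), (snorm P' : ℝ) ≤ (ak * n) ^ ((3 * k + 1) ^ q) ∧
      (snorm C' : ℝ) ≤ (ak * n + 1) ^ ((3 * k + 2) ^ q) * ℓ ∧
      (⋂ x, LSet (C x) (P x)) = LSet C' P' := by
  have hk' : (1:ℝ) ≤ k := by exact_mod_cast hk
  have hak1 : 1 ≤ ak := by linarith
  have hone : (1:ℝ) ≤ (ak * n + 1) ^ ((3 * k + 2) ^ q) := by
    apply one_le_pow₀
    have : 0 ≤ ak * n := by positivity
    linarith
  rcases Nat.eq_zero_or_pos n with hn | hn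
  · subst hn
    have hz : ∀ x, ∀ y ∈ P x, y = 0 := by
      intro x y hy
      ext i
      have := (le_snorm _ _ hy i).trans (hP x)
      simpa using this
    have hset : ∀ x, LSet (C x) (P x) = (C x : Set (Fin k → ℕ)) := by
      intro x
      ext v
      constructor
      · rintro ⟨c, hc, lam, rfl⟩
        rw [Finset.sum_eq_zero (fun y hy => by rw [hz x y hy, smul_zero]), add_zero]
        exact hc
      · intro hv
        exact ⟨v, hv, 0, by simp⟩
    obtain ⟨C', hC'⟩ := exists_finset_norm (k := k) ℓ (fun v => ∀ x, v ∈ C x)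
    refine ⟨C', ∅, ?_, ?_, ?_⟩
    · simp [snorm]
    · have : snorm C' ≤ ℓ := Finset.sup_le fun v hv => ((hC' v).1 hv).1
      calc (snorm C' : ℝ) ≤ 1 * ℓ := by rw [one_mul]; exact_mod_cast this
        _ ≤ _ := by gcongr
    · ext v
      simp only [Set.mem_iInter, hset, Finset.mem_coe]
      constructor
      · intro hv
        refine ⟨v, (hC' v).2 ⟨?_, hv⟩, 0, by simp⟩
        obtain ⟨x⟩ := ‹Nonempty χ›
        exact Finset.sup_le fun i _ => (le_snorm _ _ (hv x) i).trans (hC x)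
      · rintro ⟨c, hc, lam, rfl⟩
        simpa using ((hC' c).1 hc).2
  have hn' : (1:ℝ) ≤ n := by exact_mod_cast hn
  have han : 1 ≤ ak * n := one_le_mul_of_one_le_of_one_le hak1 hn'
  rcases Nat.eq_zero_or_pos q with hq0 | hq1
  · subst hq0
    have hc1 : Fintype.card χ ≤ 1 := by
      have := Nat.le_pow_clog (b := 2) (by norm_num) (Fintype.card χ)
      rw [← hq] at this
      simpa using this
    obtain ⟨x⟩ := ‹Nonempty χ›
    have hss : Subsingleton χ := Fintype.card_le_one_iff_subsingleton.1 hc1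
    refine ⟨C x, P x, ?_, ?_, ?_⟩
    · have h1 : (snorm (P x) : ℝ) ≤ n := by exact_mod_cast hP x
      simp only [pow_zero, pow_one]
      nlinarith
    · have h1 : (snorm (C x) : ℝ) ≤ ℓ := by exact_mod_cast hC x
      calc (snorm (C x) : ℝ) ≤ 1 * ℓ := by rw [one_mul]; exact h1
        _ ≤ _ := by gcongr
    · ext v
      simp only [Set.mem_iInter]
      exact ⟨fun h => h x, fun h y => Subsingleton.elim x y ▸ h⟩
  · obtain ⟨C', P', h1, h2, h3⟩ := inter_family C P n ℓ _ hn hP hC rfl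
    have hm : Fintype.card χ ≤ 2 ^ q := by
      rw [hq]; exact Nat.le_pow_clog (by norm_num) _
    have hN := N_bound k n (Fintype.card χ) q ak hn hk hq1 hm hak
    have he := exp_bound k hk q
    have he2 : q * (k * 2 ^ q) + 1 ≤ (3 * k + 2) ^ q := by
      have : (3 * k + 1) ^ q < (3 * k + 2) ^ q := Nat.pow_lt_pow_left (by omega) (by omega)
      omega
    refine ⟨C', P', ?_, ?_, h3⟩
    · calc (snorm P' : ℝ) ≤ _ := Nat.cast_le.2 h1
        _ ≤ _ := hN
        _ ≤ _ := pow_le_pow_right₀ han he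
    · calc (snorm C' : ℝ) ≤ _ := Nat.cast_le.2 h2
        _ = ((((2 * (Fintype.card χ * k) * n + 1) ^ (Fintype.card χ * k) : ℕ) : ℝ) * 2) * ℓ := by
          push_cast; ring
        _ ≤ ((ak * n) ^ (q * (k * 2 ^ q)) * 2) * ℓ := by gcongr
        _ ≤ ((ak * n + 1) ^ (q * (k * 2 ^ q)) * (ak * n + 1)) * ℓ := by
          gcongr
          · linarith
          · linarith
        _ = (ak * n + 1) ^ (q * (k * 2 ^ q) + 1) * ℓ := by rw [pow_succ]
        _ ≤ _ := by
          gcongr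
          linarith

/-- Intersection of finitely many semilinear sets, with bounds on the index set
and the norms of periods and constants, where `q = ⌈log₂ |X|⌉`. -/
theorem inter_many_semilinear {χ ι : Type*} (k : ℕ) (hk : 1 ≤ k)
    (X : Finset χ) (hX : X.Nonempty)
    (Idx : χ → Finset ι)
    (hdisj : ∀ x ∈ X, ∀ y ∈ X, x ≠ y → Disjoint (Idx x) (Idx y))
    (C P : ι → Finset (Fin k → ℕ))
    (n ℓ p q : ℕ) (ak : ℝ)
    (hn : n = X.sup fun x => (Idx x).sup fun i => snorm (P i))
    (hℓ : ℓ = X.sup fun x => (Idx x).sup fun i => snorm (C i))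
    (hp : p = X.sup fun x => (Idx x).card)
    (hq : q = Nat.clog 2 X.card)
    (hak : ak = 4 ^ (k + 1) * (k : ℝ) ^ ((k : ℝ) / 2)) :
    ∃ (J : Finset ℕ) (C' P' : ℕ → Finset (Fin k → ℕ)),
      (J.card : ℝ) ≤ (p : ℝ) ^ (2 ^ q) * ((ℓ : ℝ) + 1) ^ (k * 2 ^ (q + 1)) *
        (ak * (n : ℝ) + 1) ^ (4 * (3 * k + 2) ^ (q + 1)) ∧
      (∀ j ∈ J,
        (snorm (P' j) : ℝ) ≤ (ak * (n : ℝ)) ^ ((3 * k + 1) ^ q) ∧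
        (snorm (C' j) : ℝ) ≤ (ak * (n : ℝ) + 1) ^ ((3 * k + 2) ^ q) * (ℓ : ℝ)) ∧
      (⋂ x ∈ X, ⋃ i ∈ Idx x, LSet (C i) (P i)) = ⋃ j ∈ J, LSet (C' j) (P' j) := by
  classical
  haveI : Nonempty X := hX.to_subtype
  have hnb : ∀ x ∈ X, ∀ i ∈ Idx x, snorm (P i) ≤ n := by
    intro x hx i hi
    rw [hn]
    exact (Finset.le_sup (f := fun i => snorm (P i)) hi).trans
      (Finset.le_sup (f := fun x => (Idx x).sup fun i => snorm (P i)) hx)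
  have hlb : ∀ x ∈ X, ∀ i ∈ Idx x, snorm (C i) ≤ ℓ := by
    intro x hx i hi
    rw [hℓ]
    exact (Finset.le_sup (f := fun i => snorm (C i)) hi).trans
      (Finset.le_sup (f := fun x => (Idx x).sup fun i => snorm (C i)) hx)
  have hpb : ∀ x ∈ X, (Idx x).card ≤ p := by
    intro x hx
    rw [hp]
    exact Finset.le_sup (f := fun x => (Idx x).card) hx
  have hak16 : 16 * (k : ℝ) ≤ ak := hak ▸ ak_bound k hk
  have hak0 : 0 ≤ ak := le_trans (by positivity) hak16
  let F : Finset (X → ι) := Fintype.piFinset fun x : X => Idx x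
  have hmem : ∀ f : X → ι, f ∈ F ↔ ∀ x : X, f x ∈ Idx x := fun f => Fintype.mem_piFinset
  have hchoice : ∀ f : F, ∃ C' P' : Finset (Fin k → ℕ),
      (snorm P' : ℝ) ≤ (ak * n) ^ ((3 * k + 1) ^ q) ∧
      (snorm C' : ℝ) ≤ (ak * n + 1) ^ ((3 * k + 2) ^ q) * ℓ ∧
      (⋂ x : X, LSet (C (f.1 x)) (P (f.1 x))) = LSet C' P' := fun f =>
    inter_family_bound hk (fun x : X => C (f.1 x)) (fun x : X => P (f.1 x)) n ℓ q ak
      (fun x => hnb x x.2 _ ((hmem f.1).1 f.2 x)) (fun x => hlb x x.2 _ ((hmem f.1).1 f.2 x))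
      (by rw [hq, Fintype.card_coe]) hak16
  choose CC PP hPP hCC hEq using hchoice
  let e := F.equivFin
  refine ⟨Finset.range F.card, fun j => if h : j < F.card then CC (e.symm ⟨j, h⟩) else ∅,
    fun j => if h : j < F.card then PP (e.symm ⟨j, h⟩) else ∅, ?_, ?_, ?_⟩
  · have hm : X.card ≤ 2 ^ q := by
      rw [hq]; exact Nat.le_pow_clog (by norm_num) _
    have h1 : F.card ≤ p ^ (2 ^ q) := by
      calc F.card = ∏ x : X, (Idx x).card := Fintype.card_piFinset _
        _ ≤ ∏ x : X, p := Finset.prod_le_prod' fun x _ => hpb x x.2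
        _ = p ^ X.card := by simp
        _ ≤ p ^ (2 ^ q) := by
          rcases Nat.eq_zero_or_pos p with h | h
          · rw [h, zero_pow (Finset.card_pos.2 hX).ne']; exact Nat.zero_le _
          · exact Nat.pow_le_pow_right h hm
    have h2 : (1:ℝ) ≤ ((ℓ : ℝ) + 1) ^ (k * 2 ^ (q + 1)) := by
      apply one_le_pow₀
      have : (0:ℝ) ≤ ℓ := by positivity
      linarith
    have h3 : (1:ℝ) ≤ (ak * (n : ℝ) + 1) ^ (4 * (3 * k + 2) ^ (q + 1)) := by
      apply one_le_pow₀
      have : (0:ℝ) ≤ ak * n := by positivity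
      linarith
    rw [Finset.card_range]
    calc (F.card : ℝ) ≤ (p : ℝ) ^ (2 ^ q) * 1 * 1 := by
          rw [mul_one, mul_one]; exact_mod_cast h1
      _ ≤ _ := by gcongr
  · intro j hj
    rw [Finset.mem_range] at hj
    simp only [hj, dite_true]
    exact ⟨hPP _, hCC _⟩
  · ext v
    simp only [Set.mem_iInter, Set.mem_iUnion, Finset.mem_range]
    constructor
    · intro hv
      choose g hg1 hg2 using hv
      let f : F := ⟨fun x : X => g x.1 x.2, (hmem _).2 fun x => hg1 x.1 x.2⟩
      refine ⟨e f, (e f).2, ?_⟩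
      simp only [Fin.is_lt, dite_true, Fin.eta, Equiv.symm_apply_apply]
      rw [← hEq f, Set.mem_iInter]
      exact fun x => hg2 x.1 x.2
    · rintro ⟨j, hj, hv⟩ x hx
      simp only [hj, dite_true] at hv
      rw [← hEq, Set.mem_iInter] at hv
      exact ⟨_, (hmem _).1 (e.symm ⟨j, hj⟩).2 ⟨x, hx⟩, hv ⟨x, hx⟩⟩
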